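/- arXiv:1411.3012 — 2 statements merged into one kernel-verified Lean document; each statement's English description precedes it below -/
import Mathlib

section
/- If 𝓒 is an openly generated polar family of closed subsets of U, then (𝓞_𝓒)° is an openly generated polar family of closed subsets of U, and 𝓒 = (𝓞_{(𝓞_𝓒)°})°. -/
open Set Metric

section Defs

variable {X : Type*} [MetricSpace X]

/-- `V` is open in the subspace topology of `U`. -/
def IsOpenIn (U V : Set X) : Prop := ∃ W, IsOpen W ∧ V = W ∩ U

/-- `C` is closed in the subspace topology of `U`. -/
def IsClosedIn (U C : Set X) : Prop := ∃ F, IsClosed F ∧ C = F ∩ U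

/-- Closure of `C` in the subspace topology of `U` (for `C ⊆ U`). -/
def closureIn (U C : Set X) : Set X := closure C ∩ U

/-- Interior of `S` in the subspace topology of `U`. -/
def interiorIn (U S : Set X) : Set X := U \ closure (U \ S)

/-- Polar of a family `𝓞` of open subsets of `U`:  closed subsets of `U` whose intersection with
every member of `𝓞` has compact closure in `U`. -/
def polarO (U : Set X) (𝓞 : Set (Set X)) : Set (Set X) :=
  {C | IsClosedIn U C ∧ ∀ W ∈ 𝓞, IsCompact (closureIn U (C ∩ W))}

/-- Polar of a family `𝓒` of closed subsets of `U`: open subsets of `U` whose intersection with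
every member of `𝓒` has compact closure in `U`. -/
def polarC (U : Set X) (𝓒 : Set (Set X)) : Set (Set X) :=
  {V | IsOpenIn U V ∧ ∀ C ∈ 𝓒, IsCompact (closureIn U (V ∩ C))}

/-- `𝓞_𝓒`: the family of relative interiors of members of `𝓒`. -/
def oFam (U : Set X) (𝓒 : Set (Set X)) : Set (Set X) := interiorIn U '' 𝓒

/-- `𝓒_𝓞`: the family of relative closures of members of `𝓞`. -/
def cFam (U : Set X) (𝓞 : Set (Set X)) : Set (Set X) := closureIn U '' 𝓞

/-- Uniform `ε`-enlargement of `C ⊆ U`: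
`C_{uε} = {x ∈ U : ∃ y ∈ C, d(x,y) ≤ min(ε, d(y,M∖U)·(1−e^{−ε})/2)}`, where the distance to the
(possibly empty) complement of `U` is taken in `[0,∞]`. -/
def uEnl (U C : Set X) (ε : ℝ) : Set X :=
  {x | x ∈ U ∧ ∃ y ∈ C, dist x y ≤ ε ∧
    ENNReal.ofReal (dist x y) ≤ EMetric.infEdist y Uᶜ * ENNReal.ofReal ((1 - Real.exp (-ε)) / 2)}

/-- A family of closed subsets of `U` is uniformly enlargeable if each member has some uniform
`ε`-enlargement in the family. -/
def UniformlyEnlargeable (U : Set X) (𝓒 : Set (Set X)) : Prop :=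
  ∀ C ∈ 𝓒, ∃ ε : ℝ, 0 < ε ∧ uEnl U C ε ∈ 𝓒

/-- The cover-dependent `ε`-enlargement `C_ε = ⋃ᵢ cl(Uᵢ) ∩ (cl(Uᵢ) ∩ C)_{uεᵢ}`. -/
def coverEnl {I : Type*} (Ui : I → Set X) (U C : Set X) (ε : I → ℝ) : Set X :=
  ⋃ i, closure (Ui i) ∩ uEnl U (closure (Ui i) ∩ C) (ε i)

/-- The cover-dependent enlargement `C_{wε} = ⋃ᵢ (cl(Uᵢ) ∩ C)_{uεᵢ}`. -/
def coverWEnl {I : Type*} (Ui : I → Set X) (U C : Set X) (ε : I → ℝ) : Set X :=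
  ⋃ i, uEnl U (closure (Ui i) ∩ C) (ε i)

/-- A family of closed subsets of `U` is enlargeable with respect to the cover `Ui` if each
member has some cover-enlargement in the family. -/
def Enlargeable {I : Type*} (Ui : I → Set X) (U : Set X) (𝓒 : Set (Set X)) : Prop :=
  ∀ C ∈ 𝓒, ∃ ε : I → ℝ, (∀ i, 0 < ε i) ∧ coverEnl Ui U C ε ∈ 𝓒

/-- A cover of `U` by open sets with compact closures contained in `U`, locally finite in `U`. -/
structure GoodCover {I : Type*} (Ui : I → Set X) (U : Set X) : Prop where
  isOpen : ∀ i, IsOpen (Ui i)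
  covers : U ⊆ ⋃ i, Ui i
  compactCl : ∀ i, IsCompact (closure (Ui i))
  clSubset : ∀ i, closure (Ui i) ⊆ U
  locFin : ∀ x ∈ U, ∃ t ∈ nhds x, {i | (closure (Ui i) ∩ t).Nonempty}.Finite

/-- `δ(t) = ln((1+e^{−t})/(3e^{−t}−1))`. -/
noncomputable def deltaFn (t : ℝ) : ℝ :=
  Real.log ((1 + Real.exp (-t)) / (3 * Real.exp (-t) - 1))

end Defs

theorem aux_mono {X : Type*} [MetricSpace X] {U A B : Set X} (h : A ⊆ closure B)
    (hB : IsCompact (closureIn U B)) : IsCompact (closureIn U A) := by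
  have h1 : closure A ⊆ closure B := closure_minimal h isClosed_closure
  have h2 : closureIn U A = closureIn U B ∩ closure A := by
    ext x
    constructor
    · rintro ⟨a, b⟩
      exact ⟨⟨h1 a, b⟩, a⟩
    · rintro ⟨⟨_, b⟩, a⟩
      exact ⟨a, b⟩
  rw [h2]
  exact hB.inter_right isClosed_closure

theorem aux_open {X : Type*} [MetricSpace X] {U V : Set X} (hU : IsOpen U)
    (h : IsOpenIn U V) : IsOpen V := by
  obtain ⟨W, hW, rfl⟩ := h
  exact hW.inter hU

theorem aux_sub {X : Type*} [MetricSpace X] {U V : Set X}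
    (h : IsOpenIn U V) : V ⊆ U := by
  obtain ⟨W, hW, rfl⟩ := h
  exact inter_subset_right

theorem aux_int {X : Type*} [MetricSpace X] (U D : Set X) :
    IsOpenIn U (interiorIn U D) :=
  ⟨(closure (U \ D))ᶜ, isClosed_closure.isOpen_compl, by
    ext x; simp [interiorIn, and_comm]⟩

theorem aux_int_sub {X : Type*} [MetricSpace X] (U D : Set X) :
    interiorIn U D ⊆ D := by
  rintro x ⟨hx, h⟩
  by_contra hD
  exact h (subset_closure ⟨hx, hD⟩)

theorem aux_key {X : Type*} [MetricSpace X] {U : Set X} (hU : IsOpen U)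
    {O : Set (Set X)} (hO : ∀ W ∈ O, IsOpenIn U W) :
    polarO U (polarC U (cFam U O)) = polarO U (oFam U (polarO U O)) := by
  ext C
  constructor
  · rintro ⟨hC, h⟩
    refine ⟨hC, ?_⟩
    rintro _ ⟨D, ⟨hD, hD'⟩, rfl⟩
    refine h _ ⟨aux_int U D, ?_⟩
    rintro _ ⟨W, hW, rfl⟩
    refine aux_mono ?_ (hD' W hW)
    rintro x ⟨hx, hx', _⟩
    exact closure_mono (inter_subset_inter_left W (aux_int_sub U D))
      ((aux_open hU (aux_int U D)).inter_closure ⟨hx, hx'⟩)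
  · rintro ⟨hC, h⟩
    refine ⟨hC, ?_⟩
    rintro V ⟨hV, hV'⟩
    have hD : closureIn U V ∈ polarO U O := by
      refine ⟨⟨closure V, isClosed_closure, rfl⟩, fun W hW => ?_⟩
      refine aux_mono ?_ (hV' _ ⟨W, hW, rfl⟩)
      rintro x ⟨⟨hx, _⟩, hx'⟩
      have hs : V ∩ W ⊆ V ∩ closureIn U W := fun y hy =>
        ⟨hy.1, subset_closure hy.2, aux_sub hV hy.1⟩
      exact closure_mono hs ((aux_open hU (hO W hW)).closure_inter ⟨hx, hx'⟩)
    refine aux_mono ?_ (h _ ⟨_, hD, rfl⟩)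
    rintro x ⟨hx, hxV⟩
    refine subset_closure ⟨hx, aux_sub hV hxV, fun hc => ?_⟩
    obtain ⟨y, hy, hyU, hy'⟩ := mem_closure_iff.1 hc V (aux_open hU hV) hxV
    exact hy' ⟨subset_closure hy, hyU⟩

theorem aux_oFam {X : Type*} [MetricSpace X] (U : Set X) (F : Set (Set X)) :
    ∀ W ∈ oFam U F, IsOpenIn U W := by
  rintro _ ⟨D, _, rfl⟩
  exact aux_int U D

theorem aux_triple {X : Type*} [MetricSpace X] {U : Set X}
    {O : Set (Set X)} (hO : ∀ W ∈ O, IsOpenIn U W) :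
    polarO U O = polarO U (polarC U (polarO U O)) := by
  ext C
  constructor
  · intro h
    refine ⟨h.1, fun V hV => ?_⟩
    rw [inter_comm]
    exact hV.2 C h
  · intro h
    refine ⟨h.1, fun W hW => h.2 W ⟨hO W hW, fun D hD => ?_⟩⟩
    rw [inter_comm]
    exact hD.2 W hW

/-- if `𝓒` is an openly generated polar family of closed sets then so is
`(𝓞_𝓒)°`, and `𝓒 = (𝓞_{(𝓞_𝓒)°})°`. -/
theorem stmt7 {X : Type*} [MetricSpace X] [ProperSpace X]
    (U : Set X) (hU : IsOpen U)
    (𝓒 : Set (Set X)) (hcl : ∀ C ∈ 𝓒, IsClosedIn U C)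
    (hpolar : 𝓒 = polarO U (polarC U 𝓒))
    (hog : 𝓒 = polarO U (polarC U (cFam U (oFam U 𝓒)))) :
    (∀ C ∈ polarO U (oFam U 𝓒), IsClosedIn U C) ∧
    polarO U (oFam U 𝓒) = polarO U (polarC U (polarO U (oFam U 𝓒))) ∧
    polarO U (oFam U 𝓒) =
      polarO U (polarC U (cFam U (oFam U (polarO U (oFam U 𝓒))))) ∧
    𝓒 = polarO U (oFam U (polarO U (oFam U 𝓒))) := by
  have h4 : 𝓒 = polarO U (oFam U (polarO U (oFam U 𝓒))) :=
    hog.trans (aux_key hU (aux_oFam U 𝓒))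
  refine ⟨fun C hC => hC.1, aux_triple (aux_oFam U 𝓒), ?_, h4⟩
  rw [aux_key hU (aux_oFam U _), ← h4]
end

section
/- For every closed subset C of U, the family 𝓢 = {F closed in U : ∃ ε > 0, F ⊆ C_{uε}} is uniformly enlargeable, contains C, and its bipolar 𝓢°° is a polar uniformly enlargeable family of closed subsets of U. -/
open Set Metric

/-- The family of closed subsets of some uniform enlargement of `C`. -/
def ballFam {X : Type*} [MetricSpace X] (U C : Set X) : Set (Set X) :=
  {F | IsClosedIn U F ∧ ∃ ε : ℝ, 0 < ε ∧ F ⊆ uEnl U C ε}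

section Helpers

open Filter Topology

variable {X : Type*} [MetricSpace X]

lemma closedIn_sub {U C : Set X} (h : IsClosedIn U C) : C ⊆ U := by
  obtain ⟨F, -, rfl⟩ := h
  exact inter_subset_right

lemma uEnl_closed [ProperSpace X] {U C : Set X} (hC : IsClosedIn U C) (ε : ℝ) :
    IsClosedIn U (uEnl U C ε) := by
  obtain ⟨K, hK, rfl⟩ := hC
  refine ⟨{x | ∃ y ∈ K, dist x y ≤ ε ∧ ENNReal.ofReal (dist x y) ≤
    Metric.infEDist y Uᶜ * ENNReal.ofReal ((1 - Real.exp (-ε)) / 2)}, ?_, ?_⟩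
  · have hT : IsClosed {p : X × X | p.2 ∈ K ∧ dist p.1 p.2 ≤ ε ∧ ENNReal.ofReal (dist p.1 p.2) ≤
        Metric.infEDist p.2 Uᶜ * ENNReal.ofReal ((1 - Real.exp (-ε)) / 2)} := by
      refine (hK.preimage continuous_snd).inter (IsClosed.inter ?_ ?_)
      · exact isClosed_le (continuous_fst.dist continuous_snd) continuous_const
      · refine isClosed_le (ENNReal.continuous_ofReal.comp (continuous_fst.dist continuous_snd)) ?_
        exact (ENNReal.continuous_mul_const ENNReal.ofReal_ne_top).comp
          (Metric.continuous_infEDist.comp continuous_snd)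
    refine IsSeqClosed.isClosed fun u x hu hux => ?_
    choose y hyK hy1 hy2 using hu
    have hb : Bornology.IsBounded (Metric.cthickening ε (range u)) :=
      (Metric.isBounded_range_of_tendsto u hux).cthickening
    obtain ⟨a, -, φ, hφ, ha⟩ := tendsto_subseq_of_bounded hb (x := y) (fun n =>
      Metric.mem_cthickening_of_dist_le (y n) (u n) ε _ (mem_range_self n)
        (by rw [dist_comm]; exact hy1 n))
    have := hT.mem_of_tendsto ((hux.comp hφ.tendsto_atTop).prodMk_nhds ha)
      (Eventually.of_forall fun n => ⟨hyK _, hy1 _, hy2 _⟩)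
    exact ⟨a, this⟩
  · ext x
    constructor
    · rintro ⟨hx, y, hy, h1, h2⟩
      exact ⟨⟨y, hy.1, h1, h2⟩, hx⟩
    · rintro ⟨⟨y, hy, h1, h2⟩, hx⟩
      refine ⟨hx, y, ⟨hy, ?_⟩, h1, h2⟩
      by_contra hyU
      have h0 : Metric.infEDist y Uᶜ = 0 := Metric.infEDist_zero_of_mem hyU
      rw [h0, zero_mul] at h2
      have h3 : dist x y ≤ 0 := by simpa using h2
      have h4 : x = y := dist_le_zero.1 h3
      exact hyU (h4 ▸ hx)

lemma uEnl_mono {U C D : Set X} (h : C ⊆ D) {ε δ : ℝ} (hε : ε ≤ δ) :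
    uEnl U C ε ⊆ uEnl U D δ := by
  rintro x ⟨hx, y, hy, h1, h2⟩
  refine ⟨hx, y, h hy, h1.trans hε, h2.trans ?_⟩
  gcongr

lemma sub_uEnl {U C : Set X} (h : C ⊆ U) {ε : ℝ} (hε : 0 < ε) : C ⊆ uEnl U C ε := by
  intro x hx
  exact ⟨h hx, x, hx, by simpa using hε.le, by simp⟩

lemma uEnl_comp (U C : Set X) {ε : ℝ} (hε : 0 < ε) :
    ∃ δ : ℝ, 0 < δ ∧ uEnl U (uEnl U C ε) δ ⊆ uEnl U C (ε + 1) := by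
  have hlt : Real.exp (-(ε + 1)) < Real.exp (-ε) := Real.exp_lt_exp.2 (by linarith)
  have he1 : Real.exp (-ε) < 1 := by rw [Real.exp_lt_one_iff]; linarith
  have he0 := Real.exp_pos (-ε)
  set a := (1 - Real.exp (-ε)) / 2 with ha
  set a' := (1 - Real.exp (-(ε + 1))) / 2 with ha'
  have haa : a < a' := by rw [ha, ha']; linarith
  refine ⟨min 1 (a' - a), lt_min one_pos (by linarith), ?_⟩
  set δ := min 1 (a' - a) with hδ
  have hδ0 : 0 < δ := lt_min one_pos (by linarith)
  rintro x ⟨hx, z, ⟨hz, y, hy, h1, h2⟩, h3, h4⟩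
  refine ⟨hx, y, hy, ?_, ?_⟩
  · have := dist_triangle x z y
    have : δ ≤ 1 := min_le_left _ _
    linarith
  · change _ ≤ Metric.infEDist y Uᶜ * ENNReal.ofReal a'
    change _ ≤ Metric.infEDist y Uᶜ * ENNReal.ofReal a at h2
    change _ ≤ Metric.infEDist z Uᶜ * ENNReal.ofReal ((1 - Real.exp (-δ)) / 2) at h4
    set b := (1 - Real.exp (-δ)) / 2 with hb
    have hb1 : b ≤ δ / 2 := by
      have := Real.add_one_le_exp (-δ)
      rw [hb]; linarith
    have hb0 : 0 ≤ b := by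
      have : Real.exp (-δ) ≤ 1 := Real.exp_le_one_iff.2 (by linarith)
      rw [hb]; linarith
    have ha0 : 0 ≤ a := by rw [ha]; linarith
    have ha1 : a ≤ 1 := by rw [ha]; linarith
    have hδ2 : δ ≤ a' - a := min_le_right _ _
    have hI : Metric.infEDist z Uᶜ ≤
        Metric.infEDist y Uᶜ + Metric.infEDist y Uᶜ * ENNReal.ofReal a := by
      refine (Metric.infEDist_le_infEDist_add_edist (y := y)).trans ?_
      rw [edist_dist]
      gcongr
    calc ENNReal.ofReal (dist x y)
        ≤ ENNReal.ofReal (dist x z) + ENNReal.ofReal (dist z y) := by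
          rw [← ENNReal.ofReal_add dist_nonneg dist_nonneg]
          exact ENNReal.ofReal_le_ofReal (dist_triangle _ _ _)
      _ ≤ (Metric.infEDist y Uᶜ + Metric.infEDist y Uᶜ * ENNReal.ofReal a) * ENNReal.ofReal b
          + Metric.infEDist y Uᶜ * ENNReal.ofReal a := by
          refine add_le_add (h4.trans ?_) h2
          gcongr
      _ = Metric.infEDist y Uᶜ *
          (ENNReal.ofReal b + ENNReal.ofReal a * ENNReal.ofReal b + ENNReal.ofReal a) := by ring
      _ ≤ Metric.infEDist y Uᶜ * ENNReal.ofReal a' := by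
          gcongr
          rw [← ENNReal.ofReal_mul ha0, ← ENNReal.ofReal_add hb0 (by positivity),
            ← ENNReal.ofReal_add (by positivity) ha0]
          apply ENNReal.ofReal_le_ofReal
          nlinarith

lemma closureIn_compact {U A Q : Set X} (hQ : IsCompact Q) (hQU : Q ⊆ U) (h : A ⊆ Q) :
    IsCompact (closureIn U A) := by
  have h1 : closure A ⊆ Q := closure_minimal h hQ.isClosed
  have : closureIn U A = closure A := inter_eq_left.2 (h1.trans hQU)
  rw [this]
  exact hQ.of_isClosed_subset isClosed_closure h1

lemma bipolar_of_sub {U C F : Set X} {K : Set X} {ε : ℝ} (hF : IsClosedIn U F)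
    (hU : IsClosedIn U (uEnl U C ε)) (hε : 0 < ε)
    (hK : IsCompact K) (hKU : K ⊆ U) (h : F ⊆ uEnl U C ε ∪ K) :
    F ∈ polarO U (polarC U (ballFam U C)) := by
  refine ⟨hF, fun W hW => ?_⟩
  have h1 := hW.2 (uEnl U C ε) ⟨hU, ε, hε, subset_rfl⟩
  refine closureIn_compact (h1.union hK) (union_subset inter_subset_right hKU) ?_
  rintro x ⟨hxF, hxW⟩
  rcases h hxF with h2 | h2
  · exact Or.inl ⟨subset_closure ⟨hxW, h2⟩, h2.1⟩
  · exact Or.inr h2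

lemma sub_of_bipolar [ProperSpace X] {U C F : Set X} (hUo : IsOpen U) (hC : IsClosedIn U C)
    (hF : F ∈ polarO U (polarC U (ballFam U C))) :
    ∃ ε : ℝ, 0 < ε ∧ ∃ K, IsCompact K ∧ K ⊆ U ∧ F ⊆ uEnl U C ε ∪ K := by
  by_contra! hcon
  have hFU := closedIn_sub hF.1
  haveI : LocallyCompactSpace U := hUo.locallyCompactSpace
  haveI : SecondCountableTopology X := inferInstance
  let E : CompactExhaustion U := CompactExhaustion.choice U
  have hz : ∀ n : ℕ, ∃ z r, z ∈ F ∧ z ∉ Subtype.val '' (E n) ∧ 0 < r ∧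
      closedBall z r ⊆ U ∧ Disjoint (closedBall z r) (uEnl U C (n + 1)) := by
    intro n
    have h1 := hcon (n + 1) (by positivity) (Subtype.val '' (E n))
      ((E.isCompact n).image continuous_subtype_val) (by rintro _ ⟨x, -, rfl⟩; exact x.2)
    obtain ⟨z, hzF, hz⟩ := not_subset.1 h1
    rw [mem_union, not_or] at hz
    obtain ⟨G, hG, hGe⟩ := uEnl_closed hC (n + 1 : ℝ)
    have hzG : z ∉ G := fun h => hz.1 (hGe ▸ ⟨h, hFU hzF⟩)
    have hnh : U ∩ Gᶜ ∈ 𝓝 z := (hUo.inter hG.isOpen_compl).mem_nhds ⟨hFU hzF, hzG⟩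
    obtain ⟨r, hr, hrs⟩ := Metric.nhds_basis_closedBall.mem_iff.1 hnh
    refine ⟨z, r, hzF, hz.2, hr, fun x hx => (hrs hx).1, ?_⟩
    rw [Set.disjoint_left]
    intro x hx hx2
    rw [hGe] at hx2
    exact (hrs hx).2 hx2.1
  choose z r hzF hzE hr hrU hdis using hz
  have hV : (⋃ n, ball (z n) (r n)) ∈ polarC U (ballFam U C) := by
    refine ⟨⟨_, isOpen_iUnion fun n => isOpen_ball, (inter_eq_left.2 ?_).symm⟩, ?_⟩
    · exact iUnion_subset fun n => ball_subset_closedBall.trans (hrU n)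
    · rintro D ⟨hD, ε, hε, hDε⟩
      obtain ⟨m, hm⟩ := exists_nat_ge ε
      refine closureIn_compact (Q := ⋃ n ∈ Finset.range m, closedBall (z n) (r n))
        ((Finset.range m).isCompact_biUnion fun n _ => isCompact_closedBall _ _)
        (iUnion₂_subset fun n _ => hrU n) ?_
      rintro x ⟨hx, hxD⟩
      obtain ⟨n, hn⟩ := mem_iUnion.1 hx
      refine mem_iUnion₂.2 ⟨n, ?_, ball_subset_closedBall hn⟩
      rw [Finset.mem_range]
      by_contra! hnm
      refine Set.disjoint_left.1 (hdis n) (ball_subset_closedBall hn)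
        (uEnl_mono subset_rfl ?_ (hDε hxD))
      have : (m : ℝ) ≤ n := by exact_mod_cast hnm
      linarith
  have hQ := hF.2 _ hV
  have hQ2 : IsCompact ((Subtype.val : U → X) ⁻¹' (closureIn U (F ∩ ⋃ n, ball (z n) (r n)))) := by
    rw [Subtype.isCompact_iff, Subtype.image_preimage_coe, closureIn,
      inter_eq_right.2 inter_subset_right]
    exact hQ
  obtain ⟨n, hn⟩ := E.exists_superset_of_isCompact hQ2
  refine hzE n ⟨⟨z n, hFU (hzF n)⟩, hn ?_, rfl⟩
  exact ⟨subset_closure ⟨hzF n, mem_iUnion.2 ⟨n, mem_ball_self (hr n)⟩⟩, hFU (hzF n)⟩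

end Helpers

/-- `{F closed in U : ∃ ε > 0, F ⊆ C_{uε}}` is uniformly enlargeable, contains
`C`, and its bipolar is a polar uniformly enlargeable family of closed sets. -/
theorem stmt12 {X : Type*} [MetricSpace X] [ProperSpace X]
    (U : Set X) (hU : IsOpen U)
    (C : Set X) (hC : IsClosedIn U C) :
    UniformlyEnlargeable U (ballFam U C) ∧
    C ∈ ballFam U C ∧
    (∀ F ∈ polarO U (polarC U (ballFam U C)), IsClosedIn U F) ∧
    UniformlyEnlargeable U (polarO U (polarC U (ballFam U C))) ∧
    polarO U (polarC U (ballFam U C)) =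
      polarO U (polarC U (polarO U (polarC U (ballFam U C)))) := by
  have hcl := uEnl_closed hC
  refine ⟨?_, ⟨hC, 1, one_pos, sub_uEnl (closedIn_sub hC) one_pos⟩, fun F hF => hF.1, ?_, ?_⟩
  · rintro F ⟨hF, ε, hε, hFε⟩
    obtain ⟨δ, hδ, h⟩ := uEnl_comp U C hε
    exact ⟨δ, hδ, uEnl_closed hF δ, ε + 1, by linarith, (uEnl_mono hFε le_rfl).trans h⟩
  · intro F hF
    obtain ⟨ε, hε, K, hK, hKU, hFK⟩ := sub_of_bipolar hU hC hF
    obtain ⟨δ, hδ, h⟩ := uEnl_comp U C hε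
    obtain ⟨η, hη, hηU⟩ := hK.exists_cthickening_subset_open hU hKU
    refine ⟨min δ η, lt_min hδ hη, ?_⟩
    refine bipolar_of_sub (uEnl_closed hF.1 _) (hcl (ε + 1)) (by linarith)
      (hK.cthickening (r := η)) hηU ?_
    rintro x ⟨hx, y, hy, h1, h2⟩
    rcases hFK hy with h3 | h3
    · exact Or.inl (h (uEnl_mono subset_rfl (min_le_left δ η) ⟨hx, y, h3, h1, h2⟩))
    · exact Or.inr (Metric.mem_cthickening_of_dist_le x y η K h3 (h1.trans (min_le_right _ _)))
  · apply Subset.antisymm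
    · intro F hF
      refine ⟨hF.1, fun W hW => ?_⟩
      rw [inter_comm]
      exact hW.2 F hF
    · intro F hF
      refine ⟨hF.1, fun W hW => hF.2 W ⟨hW.1, fun D hD => ?_⟩⟩
      rw [inter_comm]
      exact hD.2 W hW
end
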